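/- arXiv:1211.7097 — 2 statements merged into one kernel-verified Lean document; each statement's English description precedes it below -/
import Mathlib

section
/- Let c ≠ 0 be a real number and let f : (0,1] → ℝ be continuous and satisfy f(p₁p₂) = f(p₁) + f(p₂) + c·f(p₁)·f(p₂) for all p₁, p₂ ∈ (0,1]. If f is not the constant function −1/c, then there exists α ∈ ℝ such that f(p) = (p^α − 1)/c for all p ∈ (0,1]. -/
open Set Filter Topology

/-- A continuous additive function on the nonnegative reals is linear. -/
theorem eq_mul_of_continuousOn_of_add_on_Ici {h : ℝ → ℝ} (hcont : ContinuousOn h (Ici 0))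
    (hadd : ∀ x ∈ Ici (0 : ℝ), ∀ y ∈ Ici (0 : ℝ), h (x + y) = h x + h y) :
    ∀ x ∈ Ici (0 : ℝ), h x = x * h 1 := by
  have h0 : h 0 = 0 := by
    have := hadd 0 self_mem_Ici 0 self_mem_Ici
    rw [add_zero] at this
    linarith
  let H : ℝ →+ ℝ :=
    { toFun := fun x => h (max x 0) - h (max (-x) 0)
      map_zero' := by simp
      map_add' := fun x y => by
        have nonneg (z : ℝ) : max z 0 ∈ Ici (0 : ℝ) := le_max_right z 0
        have nonneg_add (z w : ℝ) : max z 0 + max w 0 ∈ Ici (0 : ℝ) :=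
          add_nonneg (le_max_right z 0) (le_max_right w 0)
        have split (z : ℝ) : max z 0 - max (-z) 0 = z := max_zero_sub_max_neg_zero_eq_self z
        have key : max (x + y) 0 + (max (-x) 0 + max (-y) 0)
            = max (-(x + y)) 0 + (max x 0 + max y 0) := by
          linarith [split x, split y, split (x + y)]
        have hkey := congrArg h key
        rw [hadd _ (nonneg _) _ (nonneg_add _ _),
          hadd _ (nonneg _) _ (nonneg_add _ _),
          hadd _ (nonneg _) _ (nonneg _), hadd _ (nonneg _) _ (nonneg _)] at hkey
        linarith }
  have hH : Continuous H :=
    (hcont.comp_continuous (by fun_prop) fun x => le_max_right x 0).sub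
      (hcont.comp_continuous (by fun_prop) fun x => le_max_right (-x) 0)
  have hHeq : ∀ x ∈ Ici (0 : ℝ), H x = h x := fun x hx => by
    have hx' : (0 : ℝ) ≤ x := hx
    change h (max x 0) - h (max (-x) 0) = h x
    rw [max_eq_left hx', max_eq_right (neg_nonpos.2 hx'), h0, sub_zero]
  intro x hx
  have := map_real_smul H hH x 1
  rw [smul_eq_mul, smul_eq_mul, mul_one] at this
  rw [← hHeq x hx, this, hHeq 1 (mem_Ici.2 zero_le_one)]

/-- A continuous multiplicative function on `(0,1]` that vanishes somewhere vanishes everywhere. -/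
theorem eq_zero_of_multiplicativeOn_Ioc {g : ℝ → ℝ} (hcont : ContinuousOn g (Ioc 0 1))
    (hmul : ∀ p ∈ Ioc (0 : ℝ) 1, ∀ q ∈ Ioc (0 : ℝ) 1, g (p * q) = g p * g q)
    {p : ℝ} (hp : p ∈ Ioc (0 : ℝ) 1) (hgp : g p = 0) : ∀ q ∈ Ioc (0 : ℝ) 1, g q = 0 := by
  have hmem (n : ℕ) : p ^ ((1 / 2 : ℝ) ^ n) ∈ Ioc (0 : ℝ) 1 :=
    ⟨Real.rpow_pos_of_pos hp.1 _, Real.rpow_le_one hp.1.le hp.2 (by positivity)⟩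
  have hzero (n : ℕ) : g (p ^ ((1 / 2 : ℝ) ^ n)) = 0 := by
    induction n with
    | zero => simpa using hgp
    | succ n ih =>
      have h := hmul _ (hmem (n + 1)) _ (hmem (n + 1))
      rw [← Real.rpow_add hp.1, show (1 / 2 : ℝ) ^ (n + 1) + (1 / 2) ^ (n + 1) = (1 / 2) ^ n by ring,
        ih] at h
      exact mul_self_eq_zero.1 h.symm
  have hlim : Tendsto (fun n : ℕ => p ^ ((1 / 2 : ℝ) ^ n)) atTop (𝓝 1) := by
    have h := (Real.continuous_const_rpow hp.1.ne').tendsto 0 |>.comp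
      (tendsto_pow_atTop_nhds_zero_of_lt_one (r := (1 / 2 : ℝ)) (by norm_num) (by norm_num))
    simpa [Function.comp_def] using h
  have h1 : (1 : ℝ) ∈ Ioc (0 : ℝ) 1 := ⟨one_pos, le_rfl⟩
  have hg := (hcont 1 h1).tendsto.comp
    (tendsto_nhdsWithin_iff.2 ⟨hlim, Eventually.of_forall hmem⟩)
  have hg1 : g 1 = 0 := tendsto_nhds_unique hg (tendsto_const_nhds.congr fun n => (hzero n).symm)
  intro q hq
  simpa [hg1] using hmul q hq 1 h1

/-- A continuous multiplicative function on `(0,1]` that does not vanish identically is a power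
function. -/
theorem exists_eq_rpow_of_multiplicativeOn_Ioc {g : ℝ → ℝ} (hcont : ContinuousOn g (Ioc 0 1))
    (hmul : ∀ p ∈ Ioc (0 : ℝ) 1, ∀ q ∈ Ioc (0 : ℝ) 1, g (p * q) = g p * g q)
    (hne : ¬ ∀ p ∈ Ioc (0 : ℝ) 1, g p = 0) :
    ∃ α : ℝ, ∀ p ∈ Ioc (0 : ℝ) 1, g p = p ^ α := by
  have hpos : ∀ p ∈ Ioc (0 : ℝ) 1, 0 < g p := fun p hp => by
    have hs : √p ∈ Ioc (0 : ℝ) 1 := ⟨Real.sqrt_pos.2 hp.1, Real.sqrt_le_one.2 hp.2⟩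
    rw [← Real.mul_self_sqrt hp.1.le, hmul _ hs _ hs]
    exact mul_self_pos.2 fun h => hne (eq_zero_of_multiplicativeOn_Ioc hcont hmul hs h)
  have hexp : ∀ x ∈ Ici (0 : ℝ), Real.exp (-x) ∈ Ioc (0 : ℝ) 1 := fun x hx =>
    ⟨Real.exp_pos _, Real.exp_le_one_iff.2 (neg_nonpos.2 hx)⟩
  have hlin := eq_mul_of_continuousOn_of_add_on_Ici (h := fun x => Real.log (g (Real.exp (-x))))
    ((hcont.comp (by fun_prop) hexp).log fun x hx => (hpos _ (hexp x hx)).ne')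
    (fun x hx y hy => by
      rw [neg_add, Real.exp_add, hmul _ (hexp x hx) _ (hexp y hy),
        Real.log_mul (hpos _ (hexp x hx)).ne' (hpos _ (hexp y hy)).ne'])
  refine ⟨-Real.log (g (Real.exp (-1))), fun p hp => ?_⟩
  have h := hlin (-Real.log p) (neg_nonneg.2 (Real.log_nonpos hp.1.le hp.2))
  simp only [neg_neg, Real.exp_log hp.1] at h
  rw [Real.rpow_def_of_pos hp.1, ← Real.exp_log (hpos p hp), h, neg_mul, mul_neg]

/-- Uniqueness of solutions of the pseudoadditivity functional equation
`f(p₁p₂) = f(p₁) + f(p₂) + c·f(p₁)·f(p₂)` on `(0,1]`: every continuous solution which is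
not the constant `-1/c` has the form `f(p) = (p^α - 1)/c`. -/
theorem pseudoadditive_functional_equation
    (c : ℝ) (hc : c ≠ 0) (f : ℝ → ℝ)
    (hcont : ContinuousOn f (Ioc 0 1))
    (hfe : ∀ p₁ ∈ Ioc (0:ℝ) 1, ∀ p₂ ∈ Ioc (0:ℝ) 1,
      f (p₁ * p₂) = f p₁ + f p₂ + c * f p₁ * f p₂)
    (hnc : ¬ ∀ p ∈ Ioc (0:ℝ) 1, f p = -1 / c) :
    ∃ α : ℝ, ∀ p ∈ Ioc (0:ℝ) 1, f p = (p ^ α - 1) / c := by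
  obtain ⟨α, hα⟩ := exists_eq_rpow_of_multiplicativeOn_Ioc (g := fun p => 1 + c * f p)
    (by fun_prop) (fun p hp q hq => by rw [hfe p hp q hq]; ring)
    (fun h => hnc fun p hp => by
      rw [eq_div_iff hc]
      linarith [h p hp])
  refine ⟨α, fun p hp => ?_⟩
  rw [eq_div_iff hc, ← hα p hp]
  ring
end

section
/- (Uniqueness of pseudoadditive information content.) Let k > 0, let φ : ℝ⁺ → ℝ be continuous with φ(q) ≠ 0 for q ≠ 1, and let I : ℝ⁺ × (0,1] → ℝ, written I_q(p), satisfy: [S0] I₁(p) = −k ln p for all p ∈ (0,1]; [S1] I_q(p) is continuous in p ∈ (0,1] and in q ∈ ℝ⁺; [S2] for each fixed q ∈ ℝ⁺, p ↦ I_q(p) is convex on (0,1]; [S3] I_q(p₁p₂) = I_q(p₁) + I_q(p₂) + φ(q)·I_q(p₁)·I_q(p₂) for all p₁, p₂ ∈ (0,1] and q ∈ ℝ⁺; and for each q ∈ ℝ⁺, I_q is not identically zero. Then there exists a function α : ℝ⁺ → ℝ such that I_q(p) = (p^{α(q)} − 1)/φ(q) for all q ≠ 1 and p ∈ (0,1],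 where (a) α is continuous on ℝ⁺, α(1) = 0, α(q) ≠ 0 for q ≠ 1, and α(q)/φ(q) → −k as q → 1; and (b) α(q) ∈ (−∞, 0] whenever φ(q) > 0 and α(q) ∈ [0, 1] whenever φ(q) < 0. -/
open Set Filter Topology

/-- A continuous additive function on the nonnegative half-line is linear. -/
lemma eq_mul_of_additive_on_nonneg {g : ℝ → ℝ} (hc : ContinuousOn g (Ici 0))
    (hadd : ∀ x y : ℝ, 0 ≤ x → 0 ≤ y → g (x + y) = g x + g y) {t : ℝ} (ht : 0 ≤ t) :
    g t = t * g 1 := by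
  have h0 : g 0 = 0 := by
    have := hadd 0 0 le_rfl le_rfl
    rw [add_zero] at this
    linarith
  have hsub : ∀ x y : ℝ, 0 ≤ x → 0 ≤ y →
      g (max (x - y) 0) - g (max (-(x - y)) 0) = g x - g y := by
    intro x y hx hy
    rcases le_total y x with h | h
    · rw [max_eq_left (by linarith), max_eq_right (by linarith), h0]
      have := hadd (x - y) y (by linarith) hy
      rw [sub_add_cancel] at this
      linarith
    · rw [max_eq_right (by linarith), max_eq_left (by linarith), h0, neg_sub]
      have := hadd (y - x) x (by linarith) hx
      rw [sub_add_cancel] at this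
      linarith
  let G : ℝ →+ ℝ :=
    { toFun := fun s => g (max s 0) - g (max (-s) 0)
      map_zero' := by simp
      map_add' := by
        intro a b
        have key := hsub (max a 0 + max b 0) (max (-a) 0 + max (-b) 0)
          (by positivity) (by positivity)
        have split : ∀ c : ℝ, max c 0 - max (-c) 0 = c := fun c => by
          rcases le_total c 0 with h | h
          · rw [max_eq_right h, max_eq_left (by linarith)]; ring
          · rw [max_eq_left h, max_eq_right (by linarith)]; ring
        have e : max a 0 + max b 0 - (max (-a) 0 + max (-b) 0) = a + b := by
          linarith [split a, split b]
        rw [e, hadd _ _ (le_max_right _ _) (le_max_right _ _),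
          hadd _ _ (le_max_right _ _) (le_max_right _ _)] at key
        linarith }
  have hG : Continuous G :=
    (hc.comp_continuous (by fun_prop) fun s => le_max_right s 0).sub
      (hc.comp_continuous (by fun_prop) fun s => le_max_right (-s) 0)
  have hGg : ∀ s : ℝ, 0 ≤ s → G s = g s := fun s hs => by
    have := hsub s 0 hs le_rfl
    rw [sub_zero, h0, sub_zero] at this
    exact this
  have h := map_real_smul G hG t 1
  rw [smul_eq_mul, smul_eq_mul, mul_one, hGg t ht, hGg 1 zero_le_one] at h
  exact h

/-- A continuous positive multiplicative function on `(0, 1]` is a power function. -/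
lemma eq_rpow_of_multiplicative_on_Ioc {f : ℝ → ℝ} (hc : ContinuousOn f (Ioc 0 1))
    (hpos : ∀ p ∈ Ioc (0 : ℝ) 1, 0 < f p)
    (hmul : ∀ p ∈ Ioc (0 : ℝ) 1, ∀ r ∈ Ioc (0 : ℝ) 1, f (p * r) = f p * f r)
    {p : ℝ} (hp : p ∈ Ioc (0 : ℝ) 1) :
    f p = p ^ (-Real.log (f (Real.exp (-1)))) := by
  have hmem : ∀ t : ℝ, 0 ≤ t → Real.exp (-t) ∈ Ioc (0 : ℝ) 1 := fun t ht =>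
    ⟨Real.exp_pos _, Real.exp_le_one_iff.2 (by linarith)⟩
  have hlin := eq_mul_of_additive_on_nonneg (g := fun t => Real.log (f (Real.exp (-t))))
    ((hc.comp (by fun_prop) hmem).log fun t ht => (hpos _ (hmem t ht)).ne')
    (fun x y hx hy => by
      rw [neg_add, Real.exp_add, hmul _ (hmem x hx) _ (hmem y hy),
        Real.log_mul (hpos _ (hmem x hx)).ne' (hpos _ (hmem y hy)).ne'])
    (t := -Real.log p) (by linarith [Real.log_nonpos hp.1.le hp.2])
  simp only [neg_neg, Real.exp_log hp.1] at hlin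
  rw [Real.rpow_def_of_pos hp.1, ← Real.exp_log (hpos p hp), hlin]
  congr 1
  ring

/-- A continuous nonvanishing function on `(0, ∞)` that is positive at `1` is positive. -/
lemma pos_of_continuousOn_of_ne_zero {h : ℝ → ℝ} (hc : ContinuousOn h (Ioi 0))
    (hne : ∀ q : ℝ, 0 < q → h q ≠ 0) (h1 : 0 < h 1) {q : ℝ} (hq : 0 < q) : 0 < h q := by
  by_contra hle
  obtain ⟨r, hr, hr0⟩ := isPreconnected_Ioi.intermediate_value (mem_Ioi.2 hq)
    (mem_Ioi.2 one_pos) hc ⟨not_lt.1 hle, h1.le⟩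
  exact hne r hr hr0

/-- A power function that is concave on `(0, 1]` has exponent at most `1`. -/
lemma le_one_of_concaveOn_rpow {a : ℝ}
    (h : ConcaveOn ℝ (Ioc (0 : ℝ) 1) fun p => p ^ a) : a ≤ 1 := by
  by_contra! ha
  have half_mem : (1 / 2 : ℝ) ∈ Ioc (0 : ℝ) 1 := by norm_num
  have one_mem : (1 : ℝ) ∈ Ioc (0 : ℝ) 1 := by norm_num
  have half_pos : (0 : ℝ) < 1 / 2 := by norm_num
  exact absurd ((strictConvexOn_rpow ha).2 half_mem.1.le one_mem.1.le (by norm_num)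
    half_pos half_pos (by norm_num))
    (not_lt.2 (h.2 half_mem one_mem half_pos.le half_pos.le (by norm_num)))

/-- Uniqueness of the pseudoadditive information content.  `I q p` denotes `I_q(p)` for
`q ∈ ℝ⁺` and `p ∈ (0,1]`.  Under the axioms [S0]–[S3] (with `φ` continuous, `φ(q) ≠ 0`
for `q ≠ 1`, and `I_q` not identically zero for each `q`), there is `α : ℝ⁺ → ℝ` with
`I_q(p) = (p^{α(q)} - 1)/φ(q)` for `q ≠ 1`, where (a) `α` is continuous, `α(1) = 0`,
`α(q) ≠ 0` for `q ≠ 1` and `α(q)/φ(q) → -k` as `q → 1`; and (b) `α(q) ≤ 0` when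
`φ(q) > 0` and `α(q) ∈ [0,1]` when `φ(q) < 0`. -/
theorem information_content_uniqueness
    (k : ℝ) (hk : 0 < k)
    (φ : ℝ → ℝ) (hφc : ContinuousOn φ (Ioi 0))
    (hφ0 : ∀ q : ℝ, 0 < q → q ≠ 1 → φ q ≠ 0)
    (I : ℝ → ℝ → ℝ)
    -- [S0]
    (hS0 : ∀ p ∈ Ioc (0:ℝ) 1, I 1 p = -k * Real.log p)
    -- [S1] continuity in p ∈ (0,1] and in q ∈ ℝ⁺
    (hS1p : ∀ q : ℝ, 0 < q → ContinuousOn (I q) (Ioc 0 1))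
    (hS1q : ∀ p ∈ Ioc (0:ℝ) 1, ContinuousOn (fun q => I q p) (Ioi 0))
    -- [S2] convexity in p
    (hS2 : ∀ q : ℝ, 0 < q → ConvexOn ℝ (Ioc (0:ℝ) 1) (I q))
    -- [S3] pseudoadditivity
    (hS3 : ∀ q : ℝ, 0 < q → ∀ p₁ ∈ Ioc (0:ℝ) 1, ∀ p₂ ∈ Ioc (0:ℝ) 1,
      I q (p₁ * p₂) = I q p₁ + I q p₂ + φ q * I q p₁ * I q p₂)
    -- nontriviality: I_q is not identically zero
    (hnz : ∀ q : ℝ, 0 < q → ∃ p ∈ Ioc (0:ℝ) 1, I q p ≠ 0) :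
    ∃ α : ℝ → ℝ,
      (∀ q : ℝ, 0 < q → q ≠ 1 → ∀ p ∈ Ioc (0:ℝ) 1, I q p = (p ^ α q - 1) / φ q) ∧
      ContinuousOn α (Ioi 0) ∧ α 1 = 0 ∧
      (∀ q : ℝ, 0 < q → q ≠ 1 → α q ≠ 0) ∧
      Tendsto (fun q => α q / φ q) (𝓝[≠] (1 : ℝ)) (𝓝 (-k)) ∧
      (∀ q : ℝ, 0 < q → 0 < φ q → α q ≤ 0) ∧
      (∀ q : ℝ, 0 < q → φ q < 0 → α q ∈ Icc (0:ℝ) 1) := by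
  have one_mem : (1 : ℝ) ∈ Ioc (0 : ℝ) 1 := ⟨one_pos, le_rfl⟩
  have e_mem : Real.exp (-1) ∈ Ioc (0 : ℝ) 1 :=
    ⟨Real.exp_pos _, Real.exp_le_one_iff.2 (by norm_num)⟩
  have hIe : I 1 (Real.exp (-1)) = k := by
    rw [hS0 _ e_mem, Real.log_exp]
    ring
  have hφ1 : φ 1 = 0 := by
    have h := hS3 1 one_pos _ e_mem _ e_mem
    have h2 : I 1 (Real.exp (-1) * Real.exp (-1)) = 2 * k := by
      rw [hS0 _ ⟨mul_pos e_mem.1 e_mem.1, mul_le_one₀ e_mem.2 e_mem.1.le e_mem.2⟩,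
        ← Real.exp_add, Real.log_exp]
      ring
    rw [h2, hIe] at h
    have : φ 1 * (k * k) = 0 := by linarith
    exact (mul_eq_zero.1 this).resolve_right (by positivity)
  obtain ⟨f, hf⟩ : ∃ f : ℝ → ℝ → ℝ, ∀ q p, f q p = 1 + φ q * I q p := ⟨_, fun _ _ => rfl⟩
  have hmul : ∀ q : ℝ, 0 < q → ∀ p ∈ Ioc (0 : ℝ) 1, ∀ r ∈ Ioc (0 : ℝ) 1,
      f q (p * r) = f q p * f q r := by
    intro q hq p hp r hr
    rw [hf, hf, hf, hS3 q hq p hp r hr]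
    ring
  have hfq : ∀ p ∈ Ioc (0 : ℝ) 1, ContinuousOn (fun q => f q p) (Ioi 0) := fun p hp => by
    simp only [hf]
    exact continuousOn_const.add (hφc.mul (hS1q p hp))
  have hfp : ∀ q : ℝ, 0 < q → ContinuousOn (f q) (Ioc 0 1) := fun q hq =>
    (continuousOn_const.add (continuousOn_const.mul (hS1p q hq))).congr fun p _ => hf q p
  -- the constant solution `I q = -1 / φ q` is excluded by continuity in `q`
  have hf1 : ∀ q : ℝ, 0 < q → f q 1 = 1 := by
    intro q hq
    have h01 : ∀ r : ℝ, 0 < r → f r 1 = 0 ∨ f r 1 = 1 := fun r hr => by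
      have h := hmul r hr 1 one_mem 1 one_mem
      rw [mul_one] at h
      have : f r 1 * (f r 1 - 1) = 0 := by linarith
      exact (mul_eq_zero.1 this).imp id sub_eq_zero.1
    have h := pos_of_continuousOn_of_ne_zero (h := fun r => f r 1 - 1 / 2)
      ((hfq 1 one_mem).sub continuousOn_const)
      (fun r hr => by rcases h01 r hr with h | h <;> norm_num [h])
      (by simp only [hf, hφ1]; norm_num) hq
    rcases h01 q hq with h' | h'
    · norm_num [h'] at h
    · exact h'
  have hpos : ∀ q : ℝ, 0 < q → ∀ p ∈ Ioc (0 : ℝ) 1, 0 < f q p := by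
    intro q hq p hp
    have hroot : ∀ x : ℝ, x ∈ Ioc (0 : ℝ) 1 → √x ∈ Ioc (0 : ℝ) 1 := fun x hx =>
      ⟨Real.sqrt_pos.2 hx.1, Real.sqrt_le_one.2 hx.2⟩
    have hsq : ∀ x : ℝ, x ∈ Ioc (0 : ℝ) 1 → f q x = f q √x * f q √x := fun x hx => by
      rw [← hmul q hq _ (hroot x hx) _ (hroot x hx), Real.mul_self_sqrt hx.1.le]
    refine lt_of_le_of_ne (by rw [hsq p hp]; exact mul_self_nonneg _) fun h0 => ?_
    have hpn : ∀ n : ℕ, p ^ ((1 / 2 : ℝ) ^ n) ∈ Ioc (0 : ℝ) 1 ∧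
        f q (p ^ ((1 / 2 : ℝ) ^ n)) = 0 := by
      intro n
      induction n with
      | zero => simpa using And.intro hp h0.symm
      | succ n ih =>
        rw [pow_succ, Real.rpow_mul hp.1.le, ← Real.sqrt_eq_rpow]
        refine ⟨hroot _ ih.1, ?_⟩
        have := hsq _ ih.1
        rw [ih.2] at this
        exact mul_self_eq_zero.1 this.symm
    have hlim : Tendsto (fun n : ℕ => p ^ ((1 / 2 : ℝ) ^ n)) atTop (𝓝[Ioc 0 1] 1) := by
      refine tendsto_nhdsWithin_iff.2 ⟨?_, Eventually.of_forall fun n => (hpn n).1⟩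
      have := (Real.continuousAt_const_rpow (b := 0) hp.1.ne').tendsto.comp
        (tendsto_pow_atTop_nhds_zero_of_lt_one (r := (1 / 2 : ℝ)) (by norm_num) (by norm_num))
      rwa [Real.rpow_zero] at this
    have h := (hfp q hq 1 one_mem).tendsto.comp hlim
    have h' : f q 1 = 0 := tendsto_nhds_unique h
      (tendsto_const_nhds.congr fun n => (hpn n).2.symm)
    rw [hf1 q hq] at h'
    exact one_ne_zero h'
  obtain ⟨α, hα⟩ : ∃ α : ℝ → ℝ, ∀ q, α q = -Real.log (f q (Real.exp (-1))) :=
    ⟨_, fun _ => rfl⟩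
  have hpow : ∀ q : ℝ, 0 < q → ∀ p ∈ Ioc (0 : ℝ) 1, f q p = p ^ α q := fun q hq p hp => by
    rw [hα]
    exact eq_rpow_of_multiplicative_on_Ioc (hfp q hq) (hpos q hq) (hmul q hq) hp
  have hI : ∀ q : ℝ, 0 < q → q ≠ 1 → ∀ p ∈ Ioc (0 : ℝ) 1, I q p = (p ^ α q - 1) / φ q := by
    intro q hq hq1 p hp
    rw [← hpow q hq p hp, hf, add_sub_cancel_left, mul_div_cancel_left₀ _ (hφ0 q hq hq1)]
  have hαc : ContinuousOn α (Ioi 0) :=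
    ((hfq _ e_mem).log fun q hq => (hpos q hq _ e_mem).ne').neg.congr fun q _ => hα q
  have hα1 : α 1 = 0 := by simp [hα, hf, hφ1]
  have hα0 : ∀ q : ℝ, 0 < q → q ≠ 1 → α q ≠ 0 := by
    intro q hq hq1 h0
    obtain ⟨p, hp, hne⟩ := hnz q hq
    exact hne (by rw [hI q hq hq1 p hp, h0]; simp)
  have hexp : ∀ q : ℝ, 0 < q → Real.exp (-α q) = 1 + φ q * I q (Real.exp (-1)) := by
    intro q hq
    rw [← hf, hpow q hq _ e_mem, ← Real.exp_mul]
    congr 1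
    ring
  have hIpos : ∀ q : ℝ, 0 < q → 0 < I q (Real.exp (-1)) := by
    intro q hq
    refine pos_of_continuousOn_of_ne_zero (hS1q _ e_mem) (fun r hr h0 => ?_)
      (by rw [hIe]; exact hk) hq
    by_cases hr1 : r = 1
    · rw [hr1, hIe] at h0
      exact hk.ne' h0
    · have h := hexp r hr
      rw [h0, mul_zero, add_zero, Real.exp_eq_one_iff, neg_eq_zero] at h
      exact hα0 r hr hr1 h
  refine ⟨α, hI, hαc, hα1, hα0, ?_, ?_, ?_⟩
  · have hmem : ∀ᶠ q in 𝓝[≠] (1 : ℝ), 0 < q ∧ q ≠ 1 :=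
      (eventually_nhdsWithin_of_eventually_nhds (lt_mem_nhds one_pos)).and
        self_mem_nhdsWithin
    have hlimα : Tendsto α (𝓝[≠] 1) (𝓝[≠] 0) := by
      refine tendsto_nhdsWithin_iff.2 ⟨?_, hmem.mono fun q hq => hα0 q hq.1 hq.2⟩
      rw [← hα1]
      exact (hαc.continuousAt (Ioi_mem_nhds one_pos)).tendsto.mono_left nhdsWithin_le_nhds
    have hd : HasDerivAt (fun x : ℝ => Real.exp (-x)) (-1) 0 := by
      simpa using (hasDerivAt_neg (0 : ℝ)).exp
    have hslope := (hd.tendsto_slope.comp hlimα).inv₀ (by norm_num)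
    have hlimI : Tendsto (fun q => I q (Real.exp (-1))) (𝓝[≠] 1) (𝓝 k) := by
      rw [← hIe]
      exact ((hS1q _ e_mem).continuousAt (Ioi_mem_nhds one_pos)).tendsto.mono_left
        nhdsWithin_le_nhds
    have h := hslope.mul hlimI
    rw [show (-1 : ℝ)⁻¹ * k = -k by norm_num] at h
    refine h.congr' (hmem.mono fun q hq => ?_)
    have h1 := hφ0 q hq.1 hq.2
    have h2 := (hIpos q hq.1).ne'
    simp only [Function.comp, slope_def_field, hexp q hq.1, neg_zero, Real.exp_zero, sub_zero,
      add_sub_cancel_left, inv_div]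
    field_simp
  · intro q hq hφ
    have h := hexp q hq
    have h1 : 1 ≤ Real.exp (-α q) := by
      have := mul_pos hφ (hIpos q hq)
      linarith
    linarith [Real.one_le_exp_iff.1 h1]
  · intro q hq hφ
    have h := hexp q hq
    have h1 : Real.exp (-α q) ≤ 1 := by
      have := mul_neg_of_neg_of_pos hφ (hIpos q hq)
      linarith
    refine ⟨by linarith [Real.exp_le_one_iff.1 h1], le_one_of_concaveOn_rpow ?_⟩
    refine ⟨convex_Ioc 0 1, fun x hx y hy a b ha hb hab => ?_⟩
    have hc := (hS2 q hq).2 hx hy ha hb hab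
    simp only [smul_eq_mul] at hc ⊢
    have hz := (convex_Ioc (0 : ℝ) 1) hx hy ha hb hab
    simp only [smul_eq_mul] at hz
    rw [← hpow q hq x hx, ← hpow q hq y hy, ← hpow q hq _ hz, hf, hf, hf]
    have := mul_le_mul_of_nonpos_left hc hφ.le
    linear_combination this + hab
end
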